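/- arXiv:1702.02918 — 5 statements merged into one kernel-verified Lean document; each statement's English description precedes it below -/
import Mathlib

section
/- Let ≺ be an admissible order on FreeMonoid σ and let I be any two-sided ideal of A = FreeAlgebra K σ. Then the images under the quotient map A → A/I of the words in nontip(I) form a K-basis of the quotient algebra A/I. -/
open scoped TensorProduct

noncomputable section

/-- The embedding of words into the free algebra, sending a word to the product of the
corresponding generators. -/
def wordEmb (K : Type*) [Field K] (σ : Type*) : FreeMonoid σ →* FreeAlgebra K σ :=
  FreeMonoid.lift (FreeAlgebra.ι K)

/-- The coefficient function of an element of the free algebra with respect to the word basis. -/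
def coeffw (K : Type*) [Field K] (σ : Type*) (x : FreeAlgebra K σ) : FreeMonoid σ →₀ K :=
  (FreeAlgebra.basisFreeMonoid K σ).repr x

/-- A `K`-submodule of the free algebra is a two-sided ideal if it is closed under
left and right multiplication by arbitrary elements. -/
def IsIdeal2 (K : Type*) [Field K] (σ : Type*) (I : Submodule K (FreeAlgebra K σ)) : Prop :=
  ∀ a b : FreeAlgebra K σ, ∀ x ∈ I, a * x * b ∈ I

/-- The two-sided ideal generated by a set `S`. -/
def idealGen (K : Type*) [Field K] (σ : Type*) (S : Set (FreeAlgebra K σ)) :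
    Submodule K (FreeAlgebra K σ) :=
  Submodule.span K {x | ∃ a s b, s ∈ S ∧ x = a * s * b}

/-- `lt` is an admissible order on `FreeMonoid σ`: a well-order compatible with
multiplication on both sides, and such that a word is ≤ any word containing it as a factor. -/
structure IsAdmissibleOrder {σ : Type*} (lt : FreeMonoid σ → FreeMonoid σ → Prop) : Prop where
  isWellOrder : IsWellOrder (FreeMonoid σ) lt
  mul_right : ∀ p q r : FreeMonoid σ, lt p q → lt (p * r) (q * r)
  mul_left : ∀ p q s : FreeMonoid σ, lt p q → lt (s * p) (s * q)
  le_mul : ∀ q r s : FreeMonoid σ, q = r * q * s ∨ lt q (r * q * s)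

/-- A length admissible order is an admissible order in which longer words are larger. -/
structure IsLengthAdmissibleOrder {σ : Type*} (lt : FreeMonoid σ → FreeMonoid σ → Prop)
    extends IsAdmissibleOrder lt : Prop where
  length_lt : ∀ p q : FreeMonoid σ, p.length < q.length → lt p q

/-- `t` is the tip (the largest word of the support with respect to `lt`) of `x`. -/
def IsTipOf (K : Type*) [Field K] {σ : Type*} (lt : FreeMonoid σ → FreeMonoid σ → Prop)
    (t : FreeMonoid σ) (x : FreeAlgebra K σ) : Prop :=
  coeffw K σ x t ≠ 0 ∧ ∀ u, coeffw K σ x u ≠ 0 → u = t ∨ lt u t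

/-- The set of tips of the nonzero elements of `S`. -/
def tipSet (K : Type*) [Field K] {σ : Type*} (lt : FreeMonoid σ → FreeMonoid σ → Prop)
    (S : Set (FreeAlgebra K σ)) : Set (FreeMonoid σ) :=
  {t | ∃ x ∈ S, IsTipOf K lt t x}

/-- The set of nontips of `S`: words which are not a tip of an element of `S`. -/
def nontipSet (K : Type*) [Field K] {σ : Type*} (lt : FreeMonoid σ → FreeMonoid σ → Prop)
    (S : Set (FreeAlgebra K σ)) : Set (FreeMonoid σ) :=
  {w | w ∉ tipSet K lt S}

/-- `G` is a Gröbner basis of the two-sided ideal `I` with respect to `lt`. -/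
def IsGrobnerBasis (K : Type*) [Field K] {σ : Type*}
    (lt : FreeMonoid σ → FreeMonoid σ → Prop) (G : Set (FreeAlgebra K σ))
    (I : Submodule K (FreeAlgebra K σ)) : Prop :=
  G ⊆ ↑I ∧ idealGen K σ (wordEmb K σ '' tipSet K lt G) = idealGen K σ (wordEmb K σ '' tipSet K lt ↑I)

/-- `x` is homogeneous of degree `d`: every word in its support has length `d`. -/
def IsHomogOfDeg (K : Type*) [Field K] {σ : Type*} (x : FreeAlgebra K σ) (d : ℕ) : Prop :=
  ∀ w : FreeMonoid σ, coeffw K σ x w ≠ 0 → w.length = d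


theorem basis_apply_word (K : Type*) [Field K] (σ : Type*) (w : FreeMonoid σ) :
    FreeAlgebra.basisFreeMonoid K σ w = wordEmb K σ w := by
  have h : wordEmb K σ = ((FreeAlgebra.equivMonoidAlgebraFreeMonoid (R := K) (X := σ)).symm :
      MonoidAlgebra K (FreeMonoid σ) →* FreeAlgebra K σ).comp (MonoidAlgebra.of K _) := by
    apply FreeMonoid.hom_eq
    intro x
    simp [wordEmb, FreeAlgebra.equivMonoidAlgebraFreeMonoid]
  rw [h]
  simp [FreeAlgebra.basisFreeMonoid]

theorem exists_tip (K : Type*) [Field K] (σ : Type*)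
    (lt : FreeMonoid σ → FreeMonoid σ → Prop) (hlt : IsWellOrder (FreeMonoid σ) lt)
    (x : FreeAlgebra K σ) (hx : x ≠ 0) : ∃ t, IsTipOf K lt t x := by
  classical
  letI := linearOrderOfSTO lt
  have hne : (coeffw K σ x).support.Nonempty := by
    rw [Finsupp.support_nonempty_iff]
    simpa [coeffw] using hx
  obtain ⟨t, ht, hmax⟩ := Finset.exists_max_image _ id hne
  refine ⟨t, by simpa using ht, fun u hu => ?_⟩
  have := hmax u (by simpa using hu)
  exact this

/-- the images of the nontip words form a `K`-basis of `A/I`. -/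
theorem stmt1 (K : Type*) [Field K] (σ : Type*)
    (lt : FreeMonoid σ → FreeMonoid σ → Prop) (hlt : IsAdmissibleOrder lt)
    (I : Submodule K (FreeAlgebra K σ)) (hI : IsIdeal2 K σ I) :
    LinearIndependent K
      (fun n : nontipSet K lt (I : Set (FreeAlgebra K σ)) => I.mkQ (wordEmb K σ n)) ∧
    Submodule.span K (Set.range
      (fun n : nontipSet K lt (I : Set (FreeAlgebra K σ)) => I.mkQ (wordEmb K σ n))) = ⊤ := by
  classical
  have hw := hlt.isWellOrder
  set b := FreeAlgebra.basisFreeMonoid K σ with hb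
  constructor
  · rw [linearIndependent_iff]
    intro l hl
    set x : FreeAlgebra K σ := b.repr.symm (l.mapDomain Subtype.val) with hx
    have hxI : x ∈ I := by
      rw [← Submodule.Quotient.mk_eq_zero, ← Submodule.mkQ_apply, ← hl, hx,
        Module.Basis.repr_symm_apply, Finsupp.linearCombination_mapDomain,
        Finsupp.apply_linearCombination]
      congr 2
      funext n
      simp [hb, basis_apply_word]
    by_cases h0 : x = 0
    · have : l.mapDomain Subtype.val = 0 :=
        (LinearEquiv.map_eq_zero_iff b.repr.symm).mp h0
      exact Finsupp.mapDomain_injective Subtype.val_injective (by simpa using this)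
    · exfalso
      obtain ⟨t, ht⟩ := exists_tip K σ lt hw x h0
      have hc : (l.mapDomain Subtype.val) t ≠ 0 := by
        have h1 : b.repr x t ≠ 0 := ht.1
        rwa [hx, LinearEquiv.apply_symm_apply] at h1
      have hr : t ∈ Set.range (Subtype.val :
          nontipSet K lt (I : Set (FreeAlgebra K σ)) → FreeMonoid σ) := by
        by_contra hn
        exact hc (Finsupp.mapDomain_of_notMem_range _ _ hn)
      obtain ⟨n, rfl⟩ := hr
      exact n.2 ⟨x, hxI, ht⟩
  · set S := Submodule.span K (Set.range
      (fun n : nontipSet K lt (I : Set (FreeAlgebra K σ)) => I.mkQ (wordEmb K σ n))) with hS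
    have key : ∀ w, I.mkQ (b w) ∈ S := by
      intro w
      induction w using hw.wf.induction with
      | _ w ih =>
      by_cases hn : w ∈ nontipSet K lt (I : Set (FreeAlgebra K σ))
      · exact Submodule.subset_span ⟨⟨w, hn⟩, by simp [hb, basis_apply_word]⟩
      · obtain ⟨x, hxI, hc, hlow⟩ := not_not.mp hn
        change b.repr x w ≠ 0 at hc
        have hsum : I.mkQ x = 0 := by simpa using hxI
        rw [← b.linearCombination_repr x, Finsupp.linearCombination_apply, Finsupp.sum,
          map_sum, ← Finset.add_sum_erase _ _ (Finsupp.mem_support_iff.mpr hc)] at hsum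
        have h2 : ∑ u ∈ (b.repr x).support.erase w, I.mkQ (b.repr x u • b u) ∈ S := by
          refine Submodule.sum_mem _ fun u hu => ?_
          rw [map_smul]
          refine S.smul_mem _ (ih u ?_)
          rw [Finset.mem_erase, Finsupp.mem_support_iff] at hu
          exact (hlow u hu.2).resolve_left hu.1
        have h3 : (b.repr x w) • I.mkQ (b w) ∈ S := by
          rw [← map_smul]
          have := eq_neg_of_add_eq_zero_left hsum
          exact this ▸ S.neg_mem h2
        exact (S.smul_mem_iff hc).mp h3
    rw [eq_top_iff]
    rintro y -
    obtain ⟨x, rfl⟩ := I.mkQ_surjective y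
    rw [← b.linearCombination_repr x, Finsupp.linearCombination_apply, Finsupp.sum, map_sum]
    refine Submodule.sum_mem _ fun u _ => ?_
    rw [map_smul]
    exact S.smul_mem _ (key u)
end
end

section
/- Let ≺ be an admissible order on FreeMonoid σ, let I be a two-sided ideal of A = FreeAlgebra K σ, and let t be a word. If g, g' ∈ I are such that both t − g and t − g' lie in span_K(nontip(I)), then g = g'. (In particular, each element of the reduced Gröbner basis of I is uniquely determined by its tip.) -/
open scoped TensorProduct

noncomputable section

theorem coeffw_wordEmb (K : Type*) [Field K] (σ : Type*) (w : FreeMonoid σ) :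
    coeffw K σ (wordEmb K σ w) = Finsupp.single w 1 := by
  have h : wordEmb K σ w = FreeAlgebra.basisFreeMonoid K σ w := by
    have : (FreeAlgebra.basisFreeMonoid K σ w) =
      FreeAlgebra.equivMonoidAlgebraFreeMonoid.symm (MonoidAlgebra.of K (FreeMonoid σ) w) := rfl
    rw [this, AlgEquiv.eq_symm_apply]
    have h2 : ((FreeAlgebra.equivMonoidAlgebraFreeMonoid (R := K) (X := σ) :
        FreeAlgebra K σ →* MonoidAlgebra K (FreeMonoid σ)).comp (wordEmb K σ)) =
        MonoidAlgebra.of K (FreeMonoid σ) := by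
      apply FreeMonoid.hom_eq
      intro x
      simp [wordEmb, FreeAlgebra.equivMonoidAlgebraFreeMonoid]
    exact DFunLike.congr_fun h2 w
  rw [h]
  exact Module.Basis.repr_self _ _

theorem exists_isTipOf (K : Type*) [Field K] (σ : Type*)
    (lt : FreeMonoid σ → FreeMonoid σ → Prop) (hlt : IsAdmissibleOrder lt)
    (x : FreeAlgebra K σ) (hx : x ≠ 0) : ∃ t, IsTipOf K lt t x := by
  classical
  haveI := hlt.isWellOrder
  letI : LinearOrder (FreeMonoid σ) := linearOrderOfSTO lt
  have hne : (coeffw K σ x).support.Nonempty := by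
    rw [Finsupp.support_nonempty_iff]
    intro h
    exact hx ((FreeAlgebra.basisFreeMonoid K σ).repr.map_eq_zero_iff.mp h)
  obtain ⟨m, hm, hmax⟩ := (coeffw K σ x).support.exists_max_image id hne
  refine ⟨m, Finsupp.mem_support_iff.mp hm, fun u hu => ?_⟩
  exact hmax u (Finsupp.mem_support_iff.mpr hu)

theorem coeffw_eq_zero_of_mem_span (K : Type*) [Field K] (σ : Type*)
    (S : Set (FreeMonoid σ)) (x : FreeAlgebra K σ)
    (hx : x ∈ Submodule.span K (wordEmb K σ '' S)) (w : FreeMonoid σ) (hw : w ∉ S) :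
    coeffw K σ x w = 0 := by
  classical
  induction hx using Submodule.span_induction with
  | mem x h =>
    obtain ⟨v, hv, rfl⟩ := h
    rw [coeffw_wordEmb, Finsupp.single_apply, if_neg]
    rintro rfl
    exact hw hv
  | zero => simp [coeffw]
  | add x y _ _ hx hy =>
    simp only [coeffw] at *
    simp [hx, hy]
  | smul a x _ hx =>
    simp only [coeffw] at *
    simp [hx]

/-- an element of `I` with `t - g ∈ span(nontip I)` is unique. -/
theorem stmt7 (K : Type*) [Field K] (σ : Type*)
    (lt : FreeMonoid σ → FreeMonoid σ → Prop) (hlt : IsAdmissibleOrder lt)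
    (I : Submodule K (FreeAlgebra K σ)) (hI : IsIdeal2 K σ I)
    (t : FreeMonoid σ) (g g' : FreeAlgebra K σ) (hg : g ∈ I) (hg' : g' ∈ I)
    (h1 : wordEmb K σ t - g ∈
      Submodule.span K (wordEmb K σ '' nontipSet K lt (I : Set (FreeAlgebra K σ))))
    (h2 : wordEmb K σ t - g' ∈
      Submodule.span K (wordEmb K σ '' nontipSet K lt (I : Set (FreeAlgebra K σ)))) :
    g = g' := by
  by_contra hne
  obtain ⟨m, hm⟩ := exists_isTipOf K σ lt hlt (g - g') (sub_ne_zero.mpr hne)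
  have hmem := Submodule.sub_mem _ h2 h1
  rw [sub_sub_sub_cancel_left] at hmem
  refine hm.1 (coeffw_eq_zero_of_mem_span K σ _ _ hmem m ?_)
  intro hnot
  exact hnot ⟨g - g', I.sub_mem hg hg', hm⟩
end
end

section
/- Let X and Y be types, let I be a two-sided ideal of FreeAlgebra K X and I' a two-sided ideal of FreeAlgebra K Y, and set Λ = FreeAlgebra K X / I and Λ' = FreeAlgebra K Y / I'. Let φ : FreeAlgebra K (X ⊕ Y) → Λ ⊗[K] Λ' be the K-algebra map sending the generator Sum.inl x to (x mod I) ⊗ 1 and the generator Sum.inr y to 1 ⊗ (y mod I'). Let f and g be the algebra maps from FreeAlgebra K X and FreeAlgebra K Y into FreeAlgebra K (X ⊕ Y) induced by Sum.inl and Sum.inr. Then φ is surjective and its kernel is the two-sided ideal of FreeAlgebra K (X ⊕ Y) generated by f(I) ∪ g(I') ∪ {g(y)*f(x) − f(x)*g(y) : x a generator of FreeAlgebra K X, y a generator of FreeAlgebra K Y}. -/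
open scoped TensorProduct

noncomputable section

theorem idealGen_mul (K : Type*) [Field K] (σ : Type*) (S : Set (FreeAlgebra K σ))
    (a b z : FreeAlgebra K σ) (hz : z ∈ idealGen K σ S) : a * z * b ∈ idealGen K σ S := by
  unfold idealGen at *
  induction hz using Submodule.span_induction with
  | mem x hx =>
    obtain ⟨c, s, d, hs, rfl⟩ := hx
    exact Submodule.subset_span ⟨a * c, s, d * b, hs, by simp only [mul_assoc]⟩
  | zero => simp
  | add x y _ _ hx hy => rw [mul_add, add_mul]; exact add_mem hx hy
  | smul k x _ hx =>
    rw [mul_smul_comm, smul_mul_assoc]; exact Submodule.smul_mem _ _ hx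

theorem subset_idealGen (K : Type*) [Field K] (σ : Type*) (S : Set (FreeAlgebra K σ))
    (z : FreeAlgebra K σ) (hz : z ∈ S) : z ∈ idealGen K σ S :=
  Submodule.subset_span ⟨1, z, 1, hz, by simp⟩

/-- The ring congruence attached to a generated two-sided ideal. -/
def idealGenCon (K : Type*) [Field K] (σ : Type*) (S : Set (FreeAlgebra K σ)) :
    RingCon (FreeAlgebra K σ) where
  r a b := a - b ∈ idealGen K σ S
  iseqv := ⟨fun a => by simp, fun {a b} h => by simpa using neg_mem h,
    fun {a b c} h h' => by simpa using add_mem h h'⟩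
  add' {a b c d} h h' := by
    have := add_mem h h'
    rwa [sub_add_sub_comm] at this
  mul' {a b c d} h h' := by
    have h1 := idealGen_mul K σ S 1 c _ h
    have h2 := idealGen_mul K σ S b 1 _ h'
    have := add_mem h1 h2
    simpa [mul_sub, sub_mul] using this

theorem idealGenCon_mk_eq (K : Type*) [Field K] (σ : Type*) (S : Set (FreeAlgebra K σ))
    (a b : FreeAlgebra K σ) : (idealGenCon K σ S).mkₐ K a = (idealGenCon K σ S).mkₐ K b ↔
      a - b ∈ idealGen K σ S :=
  (idealGenCon K σ S).eq

theorem commute_lift_aux (K : Type*) [Field K] (X Y : Type*) {A : Type*} [Semiring A] [Algebra K A]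
    (F : FreeAlgebra K X →ₐ[K] A) (G : FreeAlgebra K Y →ₐ[K] A)
    (h : ∀ x y, Commute (F (FreeAlgebra.ι K x)) (G (FreeAlgebra.ι K y)))
    (a : FreeAlgebra K X) (b : FreeAlgebra K Y) : Commute (F a) (G b) := by
  induction a using FreeAlgebra.induction with
  | grade0 r => rw [AlgHom.commutes]; exact Algebra.commutes r _
  | mul a a' h1 h2 => rw [map_mul]; exact h1.mul_left h2
  | add a a' h1 h2 => rw [map_add]; exact h1.add_left h2
  | grade1 x =>
    induction b using FreeAlgebra.induction with
    | grade0 r => rw [AlgHom.commutes]; exact (Algebra.commutes r _).symm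
    | mul a a' h1 h2 => rw [map_mul]; exact h1.mul_right h2
    | add a a' h1 h2 => rw [map_add]; exact h1.add_right h2
    | grade1 y => exact h x y

/-- `φ : K⟨X ⊕ Y⟩ → Λ ⊗ Λ'` is surjective with kernel generated by
`f(I) ∪ g(I')` and the commutativity relations. -/
theorem stmt17 (K : Type*) [Field K] (X Y : Type*)
    (I : Submodule K (FreeAlgebra K X)) (hI : IsIdeal2 K X I)
    (I' : Submodule K (FreeAlgebra K Y)) (hI' : IsIdeal2 K Y I')
    (f : FreeAlgebra K X →ₐ[K] FreeAlgebra K (X ⊕ Y))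
    (hf : f = FreeAlgebra.lift K (fun x => FreeAlgebra.ι K (Sum.inl x)))
    (g : FreeAlgebra K Y →ₐ[K] FreeAlgebra K (X ⊕ Y))
    (hg : g = FreeAlgebra.lift K (fun y => FreeAlgebra.ι K (Sum.inr y)))
    (φ : FreeAlgebra K (X ⊕ Y) →ₐ[K]
      (RingQuot (fun a b : FreeAlgebra K X => a - b ∈ I) ⊗[K]
        RingQuot (fun a b : FreeAlgebra K Y => a - b ∈ I')))
    (hφ : φ = FreeAlgebra.lift K (Sum.elim
      (fun x => (RingQuot.mkAlgHom K (fun a b : FreeAlgebra K X => a - b ∈ I)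
        (FreeAlgebra.ι K x)) ⊗ₜ[K] 1)
      (fun y => 1 ⊗ₜ[K] (RingQuot.mkAlgHom K (fun a b : FreeAlgebra K Y => a - b ∈ I')
        (FreeAlgebra.ι K y))))) :
    Function.Surjective φ ∧
    ∀ z : FreeAlgebra K (X ⊕ Y), φ z = 0 ↔ z ∈ idealGen K (X ⊕ Y)
      ((f '' (I : Set (FreeAlgebra K X))) ∪ (g '' (I' : Set (FreeAlgebra K Y))) ∪
        {c | ∃ (x : X) (y : Y),
          c = g (FreeAlgebra.ι K y) * f (FreeAlgebra.ι K x)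
            - f (FreeAlgebra.ι K x) * g (FreeAlgebra.ι K y)}) := by
  have hφf : φ.comp f = Algebra.TensorProduct.includeLeft.comp
      (RingQuot.mkAlgHom K (fun a b : FreeAlgebra K X => a - b ∈ I)) := by
    ext x; simp [hφ, hf]
  have hφg : φ.comp g = Algebra.TensorProduct.includeRight.comp
      (RingQuot.mkAlgHom K (fun a b : FreeAlgebra K Y => a - b ∈ I')) := by
    ext x; simp [hφ, hg]
  have hφf' (a) : φ (f a) =
      (RingQuot.mkAlgHom K (fun a b : FreeAlgebra K X => a - b ∈ I) a) ⊗ₜ[K] 1 :=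
    DFunLike.congr_fun hφf a
  have hφg' (a) : φ (g a) =
      1 ⊗ₜ[K] (RingQuot.mkAlgHom K (fun a b : FreeAlgebra K Y => a - b ∈ I') a) :=
    DFunLike.congr_fun hφg a
  constructor
  · intro t
    induction t using TensorProduct.induction_on with
    | zero => exact ⟨0, map_zero _⟩
    | add a b ha hb =>
      obtain ⟨a, rfl⟩ := ha
      obtain ⟨b, rfl⟩ := hb
      exact ⟨a + b, map_add _ _ _⟩
    | tmul a b =>
      obtain ⟨a, rfl⟩ := RingQuot.mkAlgHom_surjective K _ a
      obtain ⟨b, rfl⟩ := RingQuot.mkAlgHom_surjective K _ b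
      refine ⟨f a * g b, ?_⟩
      rw [map_mul, hφf', hφg', Algebra.TensorProduct.tmul_mul_tmul, one_mul, mul_one]
  intro z
  set S : Set (FreeAlgebra K (X ⊕ Y)) :=
    ((f '' (I : Set (FreeAlgebra K X))) ∪ (g '' (I' : Set (FreeAlgebra K Y))) ∪
        {c | ∃ (x : X) (y : Y),
          c = g (FreeAlgebra.ι K y) * f (FreeAlgebra.ι K x)
            - f (FreeAlgebra.ι K x) * g (FreeAlgebra.ι K y)}) with hS
  constructor
  · intro hz
    let π := (idealGenCon K (X ⊕ Y) S).mkₐ K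
    have hπ (a b) : π a = π b ↔ a - b ∈ idealGen K (X ⊕ Y) S := idealGenCon_mk_eq K _ S a b
    let F := RingQuot.liftAlgHom K (s := fun a b : FreeAlgebra K X => a - b ∈ I) ⟨π.comp f, by
      intro a b hab
      rw [AlgHom.comp_apply, AlgHom.comp_apply, hπ, ← map_sub]
      exact subset_idealGen _ _ _ _ (Or.inl (Or.inl ⟨_, hab, rfl⟩))⟩
    let G := RingQuot.liftAlgHom K (s := fun a b : FreeAlgebra K Y => a - b ∈ I') ⟨π.comp g, by
      intro a b hab
      rw [AlgHom.comp_apply, AlgHom.comp_apply, hπ, ← map_sub]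
      exact subset_idealGen _ _ _ _ (Or.inl (Or.inr ⟨_, hab, rfl⟩))⟩
    have hF (a) : F (RingQuot.mkAlgHom K _ a) = π (f a) :=
      RingQuot.liftAlgHom_mkAlgHom_apply K _ _ a
    have hG (a) : G (RingQuot.mkAlgHom K _ a) = π (g a) :=
      RingQuot.liftAlgHom_mkAlgHom_apply K _ _ a
    have hc : ∀ a b, Commute (F a) (G b) := by
      intro a b
      obtain ⟨a, rfl⟩ := RingQuot.mkAlgHom_surjective K _ a
      obtain ⟨b, rfl⟩ := RingQuot.mkAlgHom_surjective K _ b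
      rw [hF, hG]
      refine commute_lift_aux K X Y (π.comp f) (π.comp g) ?_ a b
      intro x y
      refine Commute.symm ?_
      unfold Commute SemiconjBy
      rw [AlgHom.comp_apply, AlgHom.comp_apply, ← map_mul, ← map_mul, hπ]
      exact subset_idealGen _ _ _ _ (Or.inr ⟨x, y, rfl⟩)
    let T := Algebra.TensorProduct.lift F G hc
    have hT : T.comp φ = π := by
      apply FreeAlgebra.hom_ext
      funext s
      rcases s with x | y
      · have h1 : f (FreeAlgebra.ι K x) = FreeAlgebra.ι K (Sum.inl x) := by simp [hf]
        change T (φ (FreeAlgebra.ι K (Sum.inl x))) = π (FreeAlgebra.ι K (Sum.inl x))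
        rw [← h1, hφf', Algebra.TensorProduct.lift_tmul, map_one, mul_one, hF]
      · have h1 : g (FreeAlgebra.ι K y) = FreeAlgebra.ι K (Sum.inr y) := by simp [hg]
        change T (φ (FreeAlgebra.ι K (Sum.inr y))) = π (FreeAlgebra.ι K (Sum.inr y))
        rw [← h1, hφg', Algebra.TensorProduct.lift_tmul, map_one, one_mul, hG]
    have h0 : π z = π 0 := by
      rw [← hT, AlgHom.comp_apply, AlgHom.comp_apply, hz, map_zero, map_zero, map_zero]
    simpa using (hπ z 0).1 h0
  · intro hz
    have hgen : ∀ s ∈ S, φ s = 0 := by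
      rintro s ((⟨a, ha, rfl⟩ | ⟨a, ha, rfl⟩) | ⟨x, y, rfl⟩)
      · have : RingQuot.mkAlgHom K (fun a b : FreeAlgebra K X => a - b ∈ I) a =
            RingQuot.mkAlgHom K (fun a b : FreeAlgebra K X => a - b ∈ I) 0 :=
          RingQuot.mkAlgHom_rel K (by simpa using ha)
        rw [hφf', this, map_zero, TensorProduct.zero_tmul]
      · have : RingQuot.mkAlgHom K (fun a b : FreeAlgebra K Y => a - b ∈ I') a =
            RingQuot.mkAlgHom K (fun a b : FreeAlgebra K Y => a - b ∈ I') 0 :=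
          RingQuot.mkAlgHom_rel K (by simpa using ha)
        rw [hφg', this, map_zero, TensorProduct.tmul_zero]
      · rw [map_sub, map_mul, map_mul, hφf', hφg', Algebra.TensorProduct.tmul_mul_tmul,
          Algebra.TensorProduct.tmul_mul_tmul, one_mul, mul_one, one_mul, mul_one, sub_self]
    unfold idealGen at hz
    induction hz using Submodule.span_induction with
    | mem x hx =>
      obtain ⟨c, s, d, hs, rfl⟩ := hx
      rw [map_mul, map_mul, hgen s hs, mul_zero, zero_mul]
    | zero => exact map_zero _
    | add x y _ _ hx hy => rw [map_add, hx, hy, add_zero]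
    | smul k x _ hx => rw [map_smul, hx, smul_zero]
end
end

section
/- Let ≺ and ≺' be admissible orders on FreeMonoid X and FreeMonoid Y respectively, let I be a two-sided ideal of FreeAlgebra K X and I' a two-sided ideal of FreeAlgebra K Y, and set Λ = FreeAlgebra K X / I and Λ' = FreeAlgebra K Y / I'. Then the family {(n mod I) ⊗ (n' mod I') : n ∈ nontip(I), n' ∈ nontip(I')} is a K-basis of Λ ⊗[K] Λ'. -/
open scoped TensorProduct

noncomputable section

theorem wordEmb_eq_basis (K : Type*) [Field K] (σ : Type*) (w : FreeMonoid σ) :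
    wordEmb K σ w = FreeAlgebra.basisFreeMonoid K σ w := by
  have h : FreeAlgebra.basisFreeMonoid K σ w =
      (FreeAlgebra.equivMonoidAlgebraFreeMonoid (R := K) (X := σ)).symm
        (MonoidAlgebra.of K (FreeMonoid σ) w) := rfl
  rw [h, eq_comm, AlgEquiv.symm_apply_eq]
  induction w using FreeMonoid.inductionOn' with
  | one => rw [map_one, map_one, map_one]
  | of_mul x xs ih =>
    rw [map_mul, map_mul, map_mul, ih rfl]
    simp [wordEmb, FreeAlgebra.equivMonoidAlgebraFreeMonoid]

/-- Every nonzero finitely supported family has a largest support element. -/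
theorem exists_tip_s18 {W K : Type*} [Field K] (lt : W → W → Prop) [IsWellOrder W lt]
    (f : W →₀ K) (hf : f ≠ 0) : ∃ t, f t ≠ 0 ∧ ∀ u, f u ≠ 0 → u = t ∨ lt u t := by
  classical
  letI : LinearOrder W := linearOrderOfSTO lt
  have hne : f.support.Nonempty := Finsupp.support_nonempty_iff.mpr hf
  refine ⟨f.support.max' hne, Finsupp.mem_support_iff.mp (Finset.max'_mem _ hne), ?_⟩
  intro u hu
  exact (Finset.le_max' f.support u (Finsupp.mem_support_iff.mpr hu)).eq_or_lt

theorem nontip_li (K : Type*) [Field K] (X : Type*)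
    (lt : FreeMonoid X → FreeMonoid X → Prop) (hlt : IsAdmissibleOrder lt)
    (I : Submodule K (FreeAlgebra K X)) :
    LinearIndependent K
      (fun n : nontipSet K lt (I : Set (FreeAlgebra K X)) => I.mkQ (wordEmb K X n)) := by
  haveI := hlt.isWellOrder
  rw [linearIndependent_iff]
  intro l hl
  by_contra hne
  set x : FreeAlgebra K X := Finsupp.linearCombination K
    (fun n : nontipSet K lt (I : Set (FreeAlgebra K X)) => wordEmb K X n) l with hx
  have hxI : x ∈ I := by
    rw [← Submodule.Quotient.mk_eq_zero, ← Submodule.mkQ_apply, hx,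
      Finsupp.apply_linearCombination]
    exact hl
  have hco : coeffw K X x = Finsupp.embDomain (Function.Embedding.subtype _) l := by
    unfold coeffw
    rw [hx, Finsupp.embDomain_eq_mapDomain]
    have h2 : (fun n : nontipSet K lt (I : Set (FreeAlgebra K X)) => wordEmb K X n) =
        FreeAlgebra.basisFreeMonoid K X ∘ Subtype.val := by
      funext n
      exact wordEmb_eq_basis K X n
    rw [h2, ← Finsupp.linearCombination_mapDomain, Module.Basis.repr_linearCombination]
    rfl
  have hc0 : coeffw K X x ≠ 0 := by
    rw [hco]
    simpa using hne
  obtain ⟨t, ht, hmax⟩ := exists_tip_s18 lt (coeffw K X x) hc0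
  have htip : t ∈ tipSet K lt (I : Set (FreeAlgebra K X)) := ⟨x, hxI, ht, hmax⟩
  rw [hco] at ht
  by_cases hr : t ∈ Set.range (Function.Embedding.subtype
      (fun w => w ∈ nontipSet K lt (I : Set (FreeAlgebra K X))))
  · obtain ⟨n, rfl⟩ := hr
    exact n.2 htip
  · exact ht (Finsupp.embDomain_of_notMem_range _ _ _ hr)

theorem nontip_span (K : Type*) [Field K] (X : Type*)
    (lt : FreeMonoid X → FreeMonoid X → Prop) (hlt : IsAdmissibleOrder lt)
    (I : Submodule K (FreeAlgebra K X)) :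
    Submodule.span K (Set.range
      (fun n : nontipSet K lt (I : Set (FreeAlgebra K X)) => I.mkQ (wordEmb K X n))) = ⊤ := by
  classical
  haveI := hlt.isWellOrder
  set S := Submodule.span K (Set.range
      (fun n : nontipSet K lt (I : Set (FreeAlgebra K X)) => I.mkQ (wordEmb K X n))) with hS
  have key : ∀ w, I.mkQ (wordEmb K X w) ∈ S := by
    intro w
    induction w using (IsWellFounded.wf (r := lt)).induction with
    | _ w ih =>
      by_cases hw : w ∈ nontipSet K lt (I : Set (FreeAlgebra K X))
      · exact Submodule.subset_span ⟨⟨w, hw⟩, rfl⟩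
      · obtain ⟨x, hxI, hc, hmax⟩ := not_not.mp hw
        have hx : x = (coeffw K X x).sum fun u c => c • wordEmb K X u := by
          conv_lhs => rw [← (FreeAlgebra.basisFreeMonoid K X).linearCombination_repr x]
          rw [Finsupp.linearCombination_apply]
          simp only [wordEmb_eq_basis]
          rfl
        have h0 : I.mkQ x = 0 := by
          rw [Submodule.mkQ_apply, Submodule.Quotient.mk_eq_zero]
          exact hxI
        rw [hx, Finsupp.sum, map_sum,
          ← Finset.add_sum_erase _ _ (Finsupp.mem_support_iff.mpr hc), map_smul] at h0
        have h1 : coeffw K X x w • I.mkQ (wordEmb K X w) ∈ S := by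
          rw [eq_neg_of_add_eq_zero_left h0]
          refine S.neg_mem (S.sum_mem fun u hu => ?_)
          rw [map_smul]
          rw [Finset.mem_erase, Finsupp.mem_support_iff] at hu
          exact S.smul_mem _ (ih u ((hmax u hu.2).resolve_left hu.1))
        exact (S.smul_mem_iff hc).mp h1
  rw [eq_top_iff, ← Submodule.range_mkQ I, LinearMap.range_eq_map,
    ← (FreeAlgebra.basisFreeMonoid K X).span_eq, Submodule.map_span, Submodule.span_le]
  rintro _ ⟨_, ⟨w, rfl⟩, rfl⟩
  rw [← wordEmb_eq_basis]
  exact key w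

/-- `{(n mod I) ⊗ (n' mod I')}` for `n ∈ nontip I`, `n' ∈ nontip I'` is a
`K`-basis of `Λ ⊗[K] Λ'`. -/
theorem stmt18 (K : Type*) [Field K] (X Y : Type*)
    (ltX : FreeMonoid X → FreeMonoid X → Prop) (hltX : IsAdmissibleOrder ltX)
    (ltY : FreeMonoid Y → FreeMonoid Y → Prop) (hltY : IsAdmissibleOrder ltY)
    (I : Submodule K (FreeAlgebra K X)) (hI : IsIdeal2 K X I)
    (I' : Submodule K (FreeAlgebra K Y)) (hI' : IsIdeal2 K Y I') :
    LinearIndependent K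
      (fun p : (nontipSet K ltX (I : Set (FreeAlgebra K X))) ×
          (nontipSet K ltY (I' : Set (FreeAlgebra K Y))) =>
        (I.mkQ (wordEmb K X p.1)) ⊗ₜ[K] (I'.mkQ (wordEmb K Y p.2))) ∧
    Submodule.span K (Set.range
      (fun p : (nontipSet K ltX (I : Set (FreeAlgebra K X))) ×
          (nontipSet K ltY (I' : Set (FreeAlgebra K Y))) =>
        (I.mkQ (wordEmb K X p.1)) ⊗ₜ[K] (I'.mkQ (wordEmb K Y p.2)))) = ⊤ := by
  let b := Module.Basis.mk (nontip_li K X ltX hltX I) (nontip_span K X ltX hltX I).ge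
  let b' := Module.Basis.mk (nontip_li K Y ltY hltY I') (nontip_span K Y ltY hltY I').ge
  have h : (fun p : (nontipSet K ltX (I : Set (FreeAlgebra K X))) ×
          (nontipSet K ltY (I' : Set (FreeAlgebra K Y))) =>
        (I.mkQ (wordEmb K X p.1)) ⊗ₜ[K] (I'.mkQ (wordEmb K Y p.2))) = b.tensorProduct b' := by
    funext p
    simp [b, b', Module.Basis.tensorProduct_apply']
  rw [h]
  exact ⟨(b.tensorProduct b').linearIndependent, (b.tensorProduct b').span_eq⟩
end
end

section
/- Let λ, γ ∈ K and let Λ = K⟨x,y⟩/(y*x − λ·x*y − γ·x²), the quotient of the free algebra by the two-sided ideal generated by the single element y*x − λ·x*y − γ·x². Let ε : Λ → K be the K-algebra homomorphism (augmentation) sending the images of x and y to 0, making K a left Λ-module. Then there exists an exact sequence of left Λ-modules 0 → Λ → Λ ⊕ Λ → Λ → K → 0, where the map Λ → K is ε; in particular K has a free resolution over Λ of length 2 with ranks 1, 2, 1. -/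
open scoped TensorProduct

noncomputable section

/-- The defining relation of `Λ = K⟨x,y⟩/(yx - λ xy - γ x²)`. -/
abbrev qRel (K : Type*) [Field K] (lam gam : K) :
    FreeAlgebra K (Fin 2) → FreeAlgebra K (Fin 2) → Prop :=
  fun a b => a = FreeAlgebra.ι K (1 : Fin 2) * FreeAlgebra.ι K (0 : Fin 2)
      - lam • (FreeAlgebra.ι K (0 : Fin 2) * FreeAlgebra.ι K (1 : Fin 2))
      - gam • (FreeAlgebra.ι K (0 : Fin 2) * FreeAlgebra.ι K (0 : Fin 2)) ∧ b = 0

/-- `Λ = K⟨x,y⟩/(yx - λ xy - γ x²)`. -/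
abbrev QPlane (K : Type*) [Field K] (lam gam : K) := RingQuot (qRel K lam gam)

/-- The augmentation `ε : Λ → K` sending the images of `x` and `y` to `0`. -/
def epsAug (K : Type*) [Field K] (lam gam : K) : QPlane K lam gam →ₐ[K] K :=
  RingQuot.liftAlgHom K ⟨FreeAlgebra.lift K (fun _ => (0 : K)), by
    rintro a b ⟨ha, hb⟩
    subst ha; subst hb
    simp⟩

/-- `K` as a left `Λ`-module via the augmentation `ε`. -/
noncomputable instance (K : Type*) [Field K] (lam gam : K) : Module (QPlane K lam gam) K :=
  Module.compHom K (epsAug K lam gam).toRingHom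

/-- The augmentation as a map of left `Λ`-modules. -/
def epsLin (K : Type*) [Field K] (lam gam : K) :
    QPlane K lam gam →ₗ[QPlane K lam gam] K where
  toFun := epsAug K lam gam
  map_add' := map_add _
  map_smul' := fun r m => map_mul (epsAug K lam gam) r m


section Helpers

variable {K : Type*} [Field K] {lam gam : K}

/-- The image of `x` in `Λ`. -/
def qx (K : Type*) [Field K] (lam gam : K) : QPlane K lam gam :=
  RingQuot.mkAlgHom K (qRel K lam gam) (FreeAlgebra.ι K 0)

/-- The image of `y` in `Λ`. -/
def qy (K : Type*) [Field K] (lam gam : K) : QPlane K lam gam :=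
  RingQuot.mkAlgHom K (qRel K lam gam) (FreeAlgebra.ι K 1)

lemma q_rel : qy K lam gam * qx K lam gam =
    lam • (qx K lam gam * qy K lam gam) + gam • (qx K lam gam * qx K lam gam) := by
  have h := RingQuot.mkAlgHom_rel K (s := qRel K lam gam) (x := _) (y := 0) ⟨rfl, rfl⟩
  simp only [map_sub, map_mul, map_smul, map_zero] at h
  unfold qx qy
  rw [sub_sub, sub_eq_zero] at h
  exact h

lemma q_ind {P : QPlane K lam gam → Prop} (hK : ∀ k, P (algebraMap K _ k))
    (hx : P (qx K lam gam)) (hy : P (qy K lam gam))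
    (hmul : ∀ a b, P a → P b → P (a * b)) (hadd : ∀ a b, P a → P b → P (a + b))
    (c : QPlane K lam gam) : P c := by
  obtain ⟨f, rfl⟩ := RingQuot.mkAlgHom_surjective K (qRel K lam gam) c
  induction f using FreeAlgebra.induction with
  | grade0 r => rw [AlgHom.commutes]; exact hK r
  | grade1 i => fin_cases i; exacts [hx, hy]
  | mul a b ha hb => rw [map_mul]; exact hmul _ _ ha hb
  | add a b ha hb => rw [map_add]; exact hadd _ _ ha hb

/-- Universal property of `Λ`. -/
def qLift {A : Type*} [Ring A] [Algebra K A] (X Y : A)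
    (h : Y * X = lam • (X * Y) + gam • (X * X)) : QPlane K lam gam →ₐ[K] A :=
  RingQuot.liftAlgHom K ⟨FreeAlgebra.lift K ![X, Y], by
    rintro a b ⟨rfl, rfl⟩
    simp [h]⟩

lemma qLift_x {A : Type*} [Ring A] [Algebra K A] (X Y : A)
    (h : Y * X = lam • (X * Y) + gam • (X * X)) : qLift X Y h (qx K lam gam) = X := by
  simp [qLift, qx]

lemma qLift_y {A : Type*} [Ring A] [Algebra K A] (X Y : A)
    (h : Y * X = lam • (X * Y) + gam • (X * X)) : qLift X Y h (qy K lam gam) = Y := by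
  simp [qLift, qy]

lemma eps_x : epsAug K lam gam (qx K lam gam) = 0 := by simp [epsAug, qx]
lemma eps_y : epsAug K lam gam (qy K lam gam) = 0 := by simp [epsAug, qy]

/-! ### Injectivity -/

open Polynomial

/-- Left multiplication by `y` on the PBW model. -/
def Ly (lam gam : K) : K[X][X] →ₗ[K[X]] K[X][X] :=
  (Polynomial.basisMonomials K[X]).constr K[X] (fun i =>
    monomial i (C (lam ^ i) * X) + monomial (i + 1) (C (gam * ∑ j ∈ Finset.range i, lam ^ j)))

lemma Ly_monomial (i : ℕ) : Ly lam gam (monomial i 1) =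
    monomial i (C (lam ^ i) * X) +
      monomial (i + 1) (C (gam * ∑ j ∈ Finset.range i, lam ^ j)) := by
  have := (Polynomial.basisMonomials K[X]).constr_basis K[X] (fun i =>
    monomial i (C (lam ^ i) * X) +
      monomial (i + 1) (C (gam * ∑ j ∈ Finset.range i, lam ^ j))) i
  rwa [Polynomial.coe_basisMonomials] at this

/-- Left multiplication by `x` on the PBW model. -/
def Lx (K : Type*) [Field K] : K[X][X] →ₗ[K[X]] K[X][X] := LinearMap.mulLeft K[X] X

lemma L_rel : Ly lam gam * Lx K = lam • (Lx K * Ly lam gam) + gam • (Lx K * Lx K) := by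
  refine (Polynomial.basisMonomials K[X]).ext fun i => ?_
  simp only [Polynomial.coe_basisMonomials, Module.End.mul_apply, LinearMap.add_apply,
    LinearMap.smul_apply, Lx, LinearMap.mulLeft_apply, X_mul_monomial, Ly_monomial, mul_add]
  rw [smul_add, smul_monomial, smul_monomial, smul_monomial, add_assoc,
    add_assoc, ← map_add (monomial (i + (1 + 1)))]
  congr 2
  · rw [smul_eq_C_mul, ← mul_assoc, ← C_mul, pow_succ']
  · rw [smul_eq_C_mul, smul_eq_C_mul, mul_one, ← C_mul, ← C_add, Finset.sum_range_succ',
      mul_add, Finset.mul_sum, Finset.mul_sum, Finset.mul_sum, pow_zero, mul_one]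
    congr 2
    refine Finset.sum_congr rfl fun j _ => ?_
    ring

/-- The representation of `Λ` on the PBW model. -/
def rep (lam gam : K) : QPlane K lam gam →ₐ[K] Module.End K[X] K[X][X] :=
  qLift (Lx K) (Ly lam gam) L_rel

lemma rep_x (m : K[X][X]) : rep lam gam (qx K lam gam) m = X * m := by
  rw [rep, qLift_x]; rfl

lemma rep_y (m : K[X][X]) : rep lam gam (qy K lam gam) m = Ly lam gam m := by
  rw [rep, qLift_y]

/-- The map from the PBW model to `Λ`. -/
def psi (lam gam : K) : K[X][X] →ₗ[K] QPlane K lam gam :=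
  Polynomial.lsum (fun i => (LinearMap.mulLeft K (qx K lam gam ^ i)) ∘ₗ
    (aeval (qy K lam gam)).toLinearMap)

lemma psi_monomial (i : ℕ) (p : K[X]) :
    psi lam gam (monomial i p) = qx K lam gam ^ i * aeval (qy K lam gam) p := by
  simp [psi, Polynomial.lsum_apply, Polynomial.sum_monomial_index]

lemma psi_X (m : K[X][X]) : psi lam gam (X * m) = qx K lam gam * psi lam gam m := by
  induction m using Polynomial.induction_on' with
  | add p q hp hq => simp [mul_add, hp, hq]
  | monomial n a => rw [X_mul_monomial, psi_monomial, psi_monomial, pow_succ', mul_assoc]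

lemma Ly_X (m : K[X][X]) :
    Ly lam gam (X * m) = lam • (X * Ly lam gam m) + gam • (X * (X * m)) :=
  LinearMap.congr_fun (L_rel (lam := lam) (gam := gam)) m

lemma psi_Ly (m : K[X][X]) : psi lam gam (Ly lam gam m) = qy K lam gam * psi lam gam m := by
  induction m using Polynomial.induction_on' with
  | add p q hp hq => simp [mul_add, hp, hq]
  | monomial n a =>
    induction n with
    | zero =>
      have : (monomial 0 a : K[X][X]) = a • monomial 0 1 := by
        rw [smul_monomial, smul_eq_mul, mul_one]
      rw [this, map_smul, Ly_monomial, smul_add, smul_monomial]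
      simp [psi_monomial, smul_monomial, -monomial_zero_left, mul_comm a]
    | succ n ih =>
      rw [← X_mul_monomial, Ly_X, map_add, map_smul, map_smul, psi_X, psi_X, psi_X, ih,
        ← mul_assoc (qy K lam gam), q_rel]
      simp [add_mul, mul_assoc]

lemma psi_rep (c : QPlane K lam gam) :
    ∀ m, psi lam gam (rep lam gam c m) = c * psi lam gam m := by
  induction c using q_ind with
  | hK k => intro m; rw [AlgHom.commutes]; simp [Algebra.algebraMap_eq_smul_one]
  | hx => intro m; rw [rep_x, psi_X]
  | hy => intro m; rw [rep_y, psi_Ly]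
  | hmul a b ha hb => intro m; rw [map_mul, Module.End.mul_apply, ha, hb, mul_assoc]
  | hadd a b ha hb => intro m; rw [map_add, LinearMap.add_apply, map_add, ha, hb, add_mul]

lemma rep_dvd (c : QPlane K lam gam) :
    ∀ m : K[X][X], X ∣ m → X ∣ rep lam gam c m := by
  induction c using q_ind with
  | hK k =>
    rintro m ⟨m, rfl⟩; rw [AlgHom.commutes]
    exact ⟨k • m, by simp [Algebra.algebraMap_eq_smul_one]⟩
  | hx => intro m _; rw [rep_x]; exact dvd_mul_right _ _
  | hy =>
    rintro m ⟨m, rfl⟩; rw [rep_y, Ly_X]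
    exact ⟨lam • Ly lam gam m + gam • (X * m), by simp [mul_add]⟩
  | hmul a b ha hb => intro m h; rw [map_mul, Module.End.mul_apply]; exact ha _ (hb _ h)
  | hadd a b ha hb =>
    intro m h; rw [map_add, LinearMap.add_apply]; exact dvd_add (ha _ h) (hb _ h)

lemma psi_X_pow (n : ℕ) (m : K[X][X]) :
    psi lam gam (X ^ n * m) = qx K lam gam ^ n * psi lam gam m := by
  induction n with
  | zero => simp
  | succ n ih => rw [pow_succ', mul_assoc, psi_X, ih, pow_succ', mul_assoc]

lemma rep_x_pow (n : ℕ) (m : K[X][X]) : rep lam gam (qx K lam gam ^ n) m = X ^ n * m := by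
  induction n with
  | zero => simp
  | succ n ih => rw [pow_succ', map_mul, Module.End.mul_apply, ih, rep_x, pow_succ', mul_assoc]

lemma psi_one : psi lam gam 1 = 1 := by
  have := psi_monomial (lam := lam) (gam := gam) 0 1
  simpa using this

lemma q_inj (c : QPlane K lam gam)
    (h : c * (qy K lam gam - gam • qx K lam gam) = 0) : c = 0 := by
  by_contra hc
  set m := rep lam gam c 1 with hm
  have hcm : psi lam gam m = c := by rw [hm, psi_rep, psi_one, mul_one]
  have hm0 : m ≠ 0 := by
    intro h0; rw [h0, map_zero] at hcm; exact hc hcm.symm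
  obtain ⟨m', hm', hnd⟩ := Polynomial.exists_eq_pow_rootMultiplicity_mul_and_not_dvd m hm0 0
  rw [C_0, sub_zero] at hm' hnd
  set n := rootMultiplicity 0 m
  obtain ⟨q, hq⟩ := rep_dvd (psi lam gam m') X dvd_rfl
  have h1 : rep lam gam c X = X ^ n * (X * q) := by
    rw [← hcm, hm', psi_X_pow, map_mul, Module.End.mul_apply, hq, rep_x_pow]
  have h2 : rep lam gam c (Ly lam gam 1) = (X : K[X]) • m := by
    have : Ly lam gam 1 = (X : K[X]) • (1 : K[X][X]) := by
      have := Ly_monomial (lam := lam) (gam := gam) 0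
      simpa [Polynomial.smul_eq_C_mul] using this
    rw [this, map_smul]
  have h3 := LinearMap.congr_fun (congrArg (rep lam gam) h) 1
  rw [map_mul, map_sub, map_smul, map_zero, Module.End.mul_apply, LinearMap.sub_apply,
    LinearMap.smul_apply, rep_x, rep_y, mul_one, map_sub, h2, LinearMap.map_smul_of_tower, h1, hm',
    LinearMap.zero_apply, sub_eq_zero] at h3
  have h4 : (X : K[X][X]) ^ n * ((X : K[X]) • m') = X ^ n * (gam • (X * q)) := by
    simpa using h3
  have h5 := mul_left_cancel₀ (pow_ne_zero _ X_ne_zero) h4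
  have h6 := congrArg (fun p => coeff p 0) h5
  simp at h6
  exact hnd (X_dvd_iff.2 h6)

/-! ### Exactness -/

lemma q_aug (c : QPlane K lam gam) : ∃ a b, c = algebraMap K _ (epsAug K lam gam c) +
    a * qx K lam gam + b * qy K lam gam := by
  induction c using q_ind with
  | hK k => exact ⟨0, 0, by simp⟩
  | hx => exact ⟨1, 0, by simp [eps_x]⟩
  | hy => exact ⟨0, 1, by simp [eps_y]⟩
  | hadd c d hc hd =>
    obtain ⟨a, b, h⟩ := hc
    obtain ⟨a', b', h'⟩ := hd
    refine ⟨a + a', b + b', ?_⟩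
    conv_lhs => rw [h, h']
    simp only [map_add, add_mul]; abel
  | hmul c d hc hd =>
    obtain ⟨a, b, h⟩ := hc
    obtain ⟨a', b', h'⟩ := hd
    set k := epsAug K lam gam c
    set l := epsAug K lam gam d
    refine ⟨l • a + c * a', l • b + c * b', ?_⟩
    have e : c * algebraMap K _ l = algebraMap K _ (k * l) + (l • a) * qx K lam gam +
        (l • b) * qy K lam gam := by
      rw [← Algebra.commutes, ← Algebra.smul_def]
      conv_lhs => rw [h]
      rw [smul_add, smul_add, smul_mul_assoc, smul_mul_assoc, mul_comm k l, map_mul,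
        ← Algebra.smul_def]
    conv_lhs => rw [h']
    have e' : epsAug K lam gam (c * d) = k * l := map_mul _ _ _
    rw [mul_add, mul_add, e, e']
    simp only [add_mul, mul_assoc]; abel

/-- The second differential. -/
def dTwo (lam gam : K) :
    QPlane K lam gam →ₗ[QPlane K lam gam] QPlane K lam gam × QPlane K lam gam :=
  (LinearMap.toSpanSingleton _ _ (qy K lam gam - gam • qx K lam gam)).prod
    (LinearMap.toSpanSingleton _ _ (-(lam • qx K lam gam)))

/-- The first differential. -/
def dOne (lam gam : K) :
    QPlane K lam gam × QPlane K lam gam →ₗ[QPlane K lam gam] QPlane K lam gam :=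
  (LinearMap.toSpanSingleton _ _ (qx K lam gam)).coprod
    (LinearMap.toSpanSingleton _ _ (qy K lam gam))

lemma gen_complex {A : Type*} [Ring A] [Algebra K A] (x y c : A)
    (h : y * x = lam • (x * y) + gam • (x * x)) :
    c * (y - gam • x) * x + c * (-(lam • x)) * y = 0 := by
  rw [mul_assoc, mul_assoc, ← mul_add, sub_mul, h, neg_mul, smul_mul_assoc,
        smul_mul_assoc, add_sub_cancel_right, add_neg_cancel, mul_zero]

section Ext

variable {A N : Type*} [Ring A] [Algebra K A] [AddCommGroup N] [Module K N] [Module A N]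
  [IsScalarTower K A N]

/-- Action of a generator on the extension of `K` by `N`. -/
def gen (a : A) (e : N) : Module.End K (N × K) :=
  LinearMap.prod
    (LinearMap.coprod (Algebra.lsmul K K N a) (LinearMap.toSpanSingleton K _ e)) 0

lemma gen_apply (a : A) (e n : N) (k : K) :
    gen a e (n, k) = (a • n + k • e, 0) := by
  simp [gen]

lemma gen_rel (x y : A) (h : y * x = lam • (x * y) + gam • (x * x)) (e f : N)
    (he : y • e = lam • (x • f) + gam • (x • e)) :
    gen (K := K) y f * gen x e = lam • (gen x e * gen y f) + gam • (gen x e * gen x e) := by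
  refine LinearMap.ext fun ⟨n, k⟩ => ?_
  have hc : ∀ (a : A) (k : K) (n : N), a • k • n = k • a • n := fun a k n => by
    rw [← algebraMap_smul A k n, ← algebraMap_smul A k (a • n), ← mul_smul, ← mul_smul,
      Algebra.commutes]
  simp only [Module.End.mul_apply, LinearMap.add_apply, LinearMap.smul_apply, gen_apply]
  rw [Prod.smul_mk, Prod.smul_mk, Prod.mk_add_mk, smul_zero, smul_zero, add_zero]
  refine Prod.ext ?_ rfl
  simp only [zero_smul, add_zero, smul_add]
  rw [← mul_smul, h, add_smul, hc, he, smul_assoc, smul_assoc, mul_smul,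
    mul_smul, hc, hc, smul_add, smul_comm k lam, smul_comm k gam]
  abel

lemma fox {N : Type*} [AddCommGroup N] [Module K N] [Module (QPlane K lam gam) N]
    [IsScalarTower K (QPlane K lam gam) N] (e f : N)
    (he : qy K lam gam • e = lam • (qx K lam gam • f) + gam • (qx K lam gam • e))
    (a b : QPlane K lam gam) (h : a * qx K lam gam + b * qy K lam gam = 0) :
    a • e + b • f = 0 := by
  obtain ⟨R, hRx, hRy⟩ : ∃ R : QPlane K lam gam →ₐ[K] Module.End K (N × K),
      R (qx K lam gam) = gen (qx K lam gam) e ∧ R (qy K lam gam) = gen (qy K lam gam) f :=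
    ⟨qLift _ _ (gen_rel _ _ q_rel e f he), qLift_x _ _ _, qLift_y _ _ _⟩
  have h0 : ∀ c n, R c (n, 0) = (c • n, 0) := by
    intro c
    induction c using q_ind with
    | hK k => intro n; rw [AlgHom.commutes]; simp [Module.algebraMap_end_apply]
    | hx => intro n; rw [hRx, gen_apply]; simp
    | hy => intro n; rw [hRy, gen_apply]; simp
    | hmul a b ha hb => intro m; rw [map_mul, Module.End.mul_apply, hb, ha, mul_smul]
    | hadd a b ha hb => intro m; rw [map_add, LinearMap.add_apply, ha, hb, add_smul]; simp
  have h1 := LinearMap.congr_fun (congrArg R h) (0, 1)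
  rw [map_add, LinearMap.add_apply, map_mul, map_mul, Module.End.mul_apply, Module.End.mul_apply,
    hRx, hRy, gen_apply, gen_apply, h0, h0, map_zero] at h1
  simpa using congrArg Prod.fst h1

end Ext

lemma q_mid (a b : QPlane K lam gam) (h : a * qx K lam gam + b * qy K lam gam = 0) :
    (a, b) ∈ LinearMap.range (dTwo lam gam) := by
  let I := LinearMap.range (dTwo lam gam)
  have h2 := fox (N := (QPlane K lam gam × QPlane K lam gam) ⧸ I)
    (I.mkQ (1, 0)) (I.mkQ (0, 1)) (by
      change I.mkQ (qy K lam gam • (1, 0)) =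
        I.mkQ (lam • (qx K lam gam • (0, 1)) + gam • (qx K lam gam • (1, 0)))
      rw [← sub_eq_zero, ← map_sub, Submodule.mkQ_apply, Submodule.Quotient.mk_eq_zero]
      exact ⟨1, by simp [dTwo]⟩) a b h
  rw [← map_smul, ← map_smul, ← map_add, Submodule.mkQ_apply, Submodule.Quotient.mk_eq_zero] at h2
  have h3 : a • ((1, 0) : QPlane K lam gam × QPlane K lam gam) + b • (0, 1) = (a, b) := by simp
  rw [h3] at h2
  exact h2

end Helpers

/-- there is an exact sequence of left `Λ`-modules
`0 → Λ → Λ ⊕ Λ → Λ → K → 0` with last map the augmentation `ε`. -/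
theorem stmt19 (K : Type*) [Field K] (lam gam : K) :
    ∃ (d2 : QPlane K lam gam →ₗ[QPlane K lam gam] QPlane K lam gam × QPlane K lam gam)
      (d1 : QPlane K lam gam × QPlane K lam gam →ₗ[QPlane K lam gam] QPlane K lam gam),
      Function.Injective d2 ∧
      Function.Exact d2 d1 ∧
      Function.Exact d1 (epsLin K lam gam) ∧
      Function.Surjective (epsLin K lam gam) := by
  refine ⟨dTwo lam gam, dOne lam gam, ?_, ?_, ?_, ?_⟩
  · rw [injective_iff_map_eq_zero]
    intro c hc
    exact q_inj c (congrArg Prod.fst hc)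
  · rintro ⟨a, b⟩
    constructor
    · intro h
      exact q_mid a b h
    · rintro ⟨c, hc⟩
      rw [← hc]
      change c * (qy K lam gam - gam • qx K lam gam) * qx K lam gam +
        c * (-(lam • qx K lam gam)) * qy K lam gam = 0
      exact gen_complex (lam := lam) (gam := gam) (qx K lam gam) (qy K lam gam) c q_rel
  · intro c
    constructor
    · intro h
      obtain ⟨a, b, hab⟩ := q_aug c
      have h' : epsAug K lam gam c = 0 := h
      rw [h', map_zero, zero_add] at hab
      exact ⟨(a, b), hab.symm⟩
    · rintro ⟨⟨a, b⟩, rfl⟩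
      change epsAug K lam gam (a * qx K lam gam + b * qy K lam gam) = 0
      rw [map_add, map_mul, map_mul, eps_x, eps_y, mul_zero, mul_zero, add_zero]
  · intro k
    exact ⟨algebraMap K _ k, (epsAug K lam gam).commutes k⟩
end
end
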